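/- arXiv:2310.05043 — 2 statements merged into one kernel-verified Lean document; each statement's English description precedes it below -/
import Mathlib

section
/- Let K be a compact Hausdorff 0-dimensional space and let η : K → ω* be a topological embedding such that η[K] is a nowhere dense closed P-set in ω*. Then for all compact metrizable 0-dimensional spaces X and Y, every continuous surjection f : Y → X, every continuous map b : K → Y, and every continuous surjection g : ω* → X satisfying g ∘ η = f ∘ b, there exists a continuous surjection h : ω* → Y such that f ∘ h = g and h ∘ η = b. -/
open Set Function

/-- A topological space is 0-dimensional if the clopen sets form a base of the topology. -/
def ZeroDim (X : Type*) [TopologicalSpace X] : Prop :=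
  TopologicalSpace.IsTopologicalBasis {s : Set X | IsClopen s}

/-- A subset `P` of a topological space is a P-set if the intersection of every countable
family of neighborhoods of `P` is again a neighborhood of `P`. -/
def IsPSet {X : Type*} [TopologicalSpace X] (P : Set X) : Prop :=
  ∀ V : ℕ → Set X, (∀ n, P ⊆ interior (V n)) → P ⊆ interior (⋂ n, V n)

/-- The Čech–Stone remainder `ω* = βω \ ω` of the countable discrete space `ω`. -/
def omegaStar : Set (StoneCech ℕ) := (Set.range (stoneCechUnit : ℕ → StoneCech ℕ))ᶜ

open Filter Topology

/-- The closure in `βω` of a set of natural numbers. -/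
def betaClosure (S : Set ℕ) : Set (StoneCech ℕ) := closure (stoneCechUnit '' S)

theorem isOpen_betaClosure (S : Set ℕ) : IsOpen (betaClosure S) := by
  classical
  have hc : Continuous (fun n : ℕ => decide (n ∈ S)) := continuous_of_discreteTopology
  have hopen : IsOpen (stoneCechExtend hc ⁻¹' {true}) :=
    (isOpen_discrete _).preimage (continuous_stoneCechExtend hc)
  have hclosed : IsClosed (stoneCechExtend hc ⁻¹' {true}) :=
    (isClosed_discrete _).preimage (continuous_stoneCechExtend hc)
  have h : betaClosure S = stoneCechExtend hc ⁻¹' {true} := by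
    apply Subset.antisymm
    · apply closure_minimal _ hclosed
      rintro _ ⟨n, hn, rfl⟩
      simp [stoneCechExtend_stoneCechUnit, hn]
    · refine (Dense.open_subset_closure_inter denseRange_stoneCechUnit hopen).trans
        (closure_mono ?_)
      rintro _ ⟨h, n, rfl⟩
      simp only [mem_preimage, stoneCechExtend_stoneCechUnit, mem_singleton_iff,
        decide_eq_true_eq] at h
      exact ⟨n, h, rfl⟩
  rwa [h]

theorem isOpen_singleton_stoneCechUnit (n : ℕ) : IsOpen {(stoneCechUnit n : StoneCech ℕ)} := by
  have h := isOpen_betaClosure {n}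
  rwa [betaClosure, image_singleton, closure_singleton] at h

theorem isClosed_omegaStar : IsClosed omegaStar := by
  have h : IsOpen (range (stoneCechUnit : ℕ → StoneCech ℕ)) := by
    rw [← iUnion_singleton_eq_range]
    exact isOpen_iUnion isOpen_singleton_stoneCechUnit
  exact h.isClosed_compl

theorem stoneCechUnit_nat_injective : Injective (stoneCechUnit : ℕ → StoneCech ℕ) := by
  classical
  intro m n h
  have hc : Continuous (fun k : ℕ => decide (k = n)) := continuous_of_discreteTopology
  simpa using eq_if_stoneCechUnit_eq hc h

theorem betaClosure_union (S T : Set ℕ) :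
    betaClosure (S ∪ T) = betaClosure S ∪ betaClosure T := by
  simp [betaClosure, image_union, closure_union]

theorem betaClosure_mono {S T : Set ℕ} (h : S ⊆ T) : betaClosure S ⊆ betaClosure T :=
  closure_mono (image_mono h)

theorem betaClosure_univ : betaClosure univ = univ := by
  rw [betaClosure, image_univ]
  exact denseRange_stoneCechUnit.closure_range

theorem mem_betaClosure_diff {p : StoneCech ℕ} (hp : p ∈ omegaStar) {S F : Set ℕ}
    (hF : F.Finite) (h : p ∈ betaClosure S) : p ∈ betaClosure (S \ F) := by
  have h1 : p ∈ betaClosure (S \ F ∪ F) := betaClosure_mono (by simp) h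
  rw [betaClosure_union] at h1
  refine h1.resolve_right fun h2 => hp ?_
  rw [betaClosure, (hF.image _).isClosed.closure_eq] at h2
  exact image_subset_range _ _ h2

theorem frequently_of_mem_betaClosure {p : StoneCech ℕ} (hp : p ∈ omegaStar) {S : Set ℕ}
    (h : p ∈ betaClosure S) {O : Set (StoneCech ℕ)} (hO : O ∈ 𝓝 p) :
    ∃ᶠ n in atTop, n ∈ S ∧ (stoneCechUnit n : StoneCech ℕ) ∈ O := by
  rw [← Nat.cofinite_eq_atTop, frequently_cofinite_iff_infinite]
  intro hF
  have h1 := mem_betaClosure_diff hp hF h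
  obtain ⟨_, hx, n, ⟨hn, hn'⟩, rfl⟩ := mem_closure_iff_nhds.1 h1 O hO
  exact hn' ⟨hn, hx⟩

theorem nonempty_betaClosure_inter_omegaStar {S : Set ℕ} (hS : S.Infinite) :
    (betaClosure S ∩ omegaStar).Nonempty := by
  obtain ⟨p, hp⟩ := (hS.image stoneCechUnit_nat_injective.injOn).exists_accPt_principal
  refine ⟨p, mem_closure_iff_clusterPt.2 hp.clusterPt, ?_⟩
  rintro ⟨n, rfl⟩
  have h1 : (𝓝[≠] (stoneCechUnit n : StoneCech ℕ)) = ⊥ :=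
    isOpen_singleton_iff_punctured_nhds _ |>.1 (isOpen_singleton_stoneCechUnit n)
  have h2 : (𝓝[≠] (stoneCechUnit n : StoneCech ℕ) ⊓ 𝓟 (stoneCechUnit '' S)).NeBot := hp
  rw [h1, bot_inf_eq] at h2
  exact h2.ne rfl

/-- If two functions on `ω` are asymptotically equal along `S`, their extensions agree on the
part of the remainder lying in the closure of `S`. -/
theorem eq_of_tendsto_dist {X : Type*} [MetricSpace X] {F G : StoneCech ℕ → X}
    (hF : Continuous F) (hG : Continuous G) {S : Set ℕ}
    (h : ∀ ε > 0, ∀ᶠ n in atTop, n ∈ S → dist (F (stoneCechUnit n)) (G (stoneCechUnit n)) < ε)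
    {p : StoneCech ℕ} (hp : p ∈ omegaStar) (hpS : p ∈ betaClosure S) : F p = G p := by
  by_contra hne
  have hpos : 0 < dist (F p) (G p) := dist_pos.2 hne
  have hO : {q | dist (F p) (G p) / 2 < dist (F q) (G q)} ∈ 𝓝 p :=
    (isOpen_lt continuous_const (hF.dist hG)).mem_nhds (by simpa using hpos)
  obtain ⟨n, ⟨hn, hn'⟩, hd⟩ :=
    ((frequently_of_mem_betaClosure hp hpS hO).and_eventually (h _ (half_pos hpos))).exists
  exact lt_asymm hn' (hd hn)

theorem eqOn_betaClosure {X : Type*} [TopologicalSpace X] [T2Space X] {F G : StoneCech ℕ → X}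
    (hF : Continuous F) (hG : Continuous G) {S : Set ℕ}
    (h : ∀ n ∈ S, F (stoneCechUnit n) = G (stoneCechUnit n)) : EqOn F G (betaClosure S) := by
  apply EqOn.closure _ hF hG
  rintro _ ⟨n, hn, rfl⟩
  exact h n hn

theorem exists_extension_of_embedding_metric {X E C : Type*} [TopologicalSpace X] [CompactSpace X]
    [T2Space X] [Nonempty X] [MetricSpace E] [TietzeExtension.{0} E] {ι : X → E}
    (hι : Continuous ι) (hinj : Injective ι) [TopologicalSpace C] {e : C → StoneCech ℕ}
    (he : IsClosedEmbedding e) {φ : C → X} (hφ : Continuous φ) :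
    ∃ F : StoneCech ℕ → X, Continuous F ∧ ∀ c, F (e c) = φ c := by
  obtain ⟨T, hT⟩ := ContinuousMap.exists_extension' he ⟨ι ∘ φ, hι.comp hφ⟩
  have hmin : ∀ n : ℕ, ∃ x : X,
      dist (T (stoneCechUnit n)) (ι x) = Metric.infDist (T (stoneCechUnit n)) (range ι) := by
    intro n
    obtain ⟨_, ⟨x, rfl⟩, hx⟩ := (isCompact_range hι).exists_infDist_eq_dist
      (range_nonempty ι) (T (stoneCechUnit n))
    exact ⟨x, hx.symm⟩
  choose r hr using hmin
  have hrc : Continuous r := continuous_of_discreteTopology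
  have hF := continuous_stoneCechExtend hrc
  have key : (fun p => dist (T p) (ι (stoneCechExtend hrc p))) =
      fun p => Metric.infDist (T p) (range ι) := by
    apply stoneCech_hom_ext
    · fun_prop
    · exact (Metric.continuous_infDist_pt _).comp T.continuous
    · funext n
      simpa [stoneCechExtend_stoneCechUnit] using hr n
  refine ⟨stoneCechExtend hrc, hF, fun c => hinj ?_⟩
  have hTc : T (e c) = ι (φ c) := congr_fun hT c
  have h1 := congr_fun key (e c)
  rw [hTc, Metric.infDist_zero_of_mem (mem_range_self _)] at h1
  exact (dist_eq_zero.1 h1).symm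

/-- Continuous maps from closed subspaces of `βω` to nonempty compact metrizable spaces extend
to `βω`. -/
theorem exists_continuous_extension_stoneCech {X C : Type*} [TopologicalSpace X] [CompactSpace X]
    [TopologicalSpace.MetrizableSpace X] [Nonempty X] [TopologicalSpace C] {e : C → StoneCech ℕ}
    (he : IsClosedEmbedding e) {φ : C → X} (hφ : Continuous φ) :
    ∃ F : StoneCech ℕ → X, Continuous F ∧ ∀ c, F (e c) = φ c := by
  let := TopologicalSpace.metrizableSpaceMetric X
  let : MetricSpace (ℕ → ℝ) := TopologicalSpace.metrizableSpaceMetric (ℕ → ℝ)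
  let ι : X → ℕ → ℝ := fun x n => dist x (TopologicalSpace.denseSeq X n)
  have hι : Continuous ι := by
    apply continuous_pi
    intro n
    exact continuous_id.dist continuous_const
  have hinj : Injective ι := by
    intro x y hxy
    have h : (fun z => dist x z) = fun z => dist y z := by
      apply (TopologicalSpace.denseRange_denseSeq X).equalizer
      · fun_prop
      · fun_prop
      · funext n
        exact congr_fun hxy n
    have h1 := congr_fun h y
    simp only [dist_self] at h1
    exact dist_eq_zero.1 h1
  exact exists_extension_of_embedding_metric hι hinj he hφ

/-- Fibres of a continuous map from the remainder to a metrizable space are not contained in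
nowhere dense closed sets. -/
theorem exists_notMem_fiber {X : Type*} [MetricSpace X] {G : StoneCech ℕ → X}
    (hG : Continuous G) {P : Set ↥omegaStar} (hP : interior P = ∅) (p : ↥omegaStar) :
    ∃ w : ↥omegaStar, w ∉ P ∧ G w = G p := by
  have hfreq : ∀ i : ℕ, ∃ᶠ n in atTop, dist (G (stoneCechUnit n)) (G p) < 1 / ((i : ℝ) + 1) := by
    intro i
    have hO : {q | dist (G q) (G p) < 1 / ((i : ℝ) + 1)} ∈ 𝓝 (p : StoneCech ℕ) :=
      (isOpen_lt (hG.dist continuous_const) continuous_const).mem_nhds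
        (by simpa using by positivity)
    exact (frequently_of_mem_betaClosure (S := univ) p.2 (by simp [betaClosure_univ]) hO).mono
      fun n hn => hn.2
  obtain ⟨ν, hν, hνd⟩ := extraction_forall_of_frequently hfreq
  have hopen : IsOpen ((↑) ⁻¹' betaClosure (range ν) : Set ↥omegaStar) :=
    (isOpen_betaClosure _).preimage continuous_subtype_val
  obtain ⟨q, hq, hq'⟩ :=
    nonempty_betaClosure_inter_omegaStar (infinite_range_of_injective hν.injective)
  have hnot : ¬ ((↑) ⁻¹' betaClosure (range ν) : Set ↥omegaStar) ⊆ P := by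
    intro hsub
    have : (⟨q, hq'⟩ : ↥omegaStar) ∈ interior P := interior_maximal hsub hopen hq
    simp [hP] at this
  obtain ⟨w, hw, hwP⟩ := not_subset.1 hnot
  refine ⟨w, hwP, eq_of_tendsto_dist hG continuous_const (S := range ν) ?_ w.2 hw⟩
  intro ε hε
  obtain ⟨m, hm⟩ := exists_nat_one_div_lt hε
  filter_upwards [eventually_ge_atTop (ν m)] with n hn
  rintro ⟨i, rfl⟩
  have hmi : m ≤ i := hν.le_iff_le.1 hn
  exact (hνd i).trans_le ((Nat.one_div_le_one_div hmi).trans hm.le)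

/-- Closed sets inside open sets of `βω` are contained in the closure of a set of natural numbers
whose closure stays inside the open set. -/
theorem exists_betaClosure_between {P O : Set (StoneCech ℕ)} (hP : IsClosed P) (hO : IsOpen O)
    (h : P ⊆ O) : ∃ A : Set ℕ, P ⊆ betaClosure A ∧ betaClosure A ⊆ O := by
  obtain ⟨V, hV, hPV, hVO⟩ := normal_exists_closure_subset hP hO h
  refine ⟨stoneCechUnit ⁻¹' V, ?_, (closure_mono (image_preimage_subset _ _)).trans hVO⟩
  rw [betaClosure, image_preimage_eq_inter_range]
  exact hPV.trans (Dense.open_subset_closure_inter denseRange_stoneCechUnit hV)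

theorem IsPSet.subset_interior_of_isGδ {X : Type*} [TopologicalSpace X] {P S : Set X}
    (hP : IsPSet P) (hS : IsGδ S) (h : P ⊆ S) : P ⊆ interior S := by
  obtain ⟨V, hV, rfl⟩ := isGδ_iff_eq_iInter_nat.1 hS
  apply hP V
  intro n
  rw [(hV n).interior_eq]
  exact h.trans (iInter_subset _ n)

/-- Lifting of a sequence along a surjection, asymptotically on the complement of `A`, such that
the lift takes each of countably many prescribed values infinitely often. -/
theorem exists_asymptotic_lift {X Y : Type*} [MetricSpace X] {f : Y → X} (hfs : Surjective f)
    (u : ℕ → X) (B : ℕ → Y) (y : ℕ → Y) (A : Set ℕ)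
    (hfreq : ∀ k, ∀ ε > 0, ∃ᶠ n in atTop, n ∈ Aᶜ ∧ dist (u n) (f (y k)) < ε) :
    ∃ H : ℕ → Y, (∀ n ∈ A, H n = B n) ∧
      (∀ ε > 0, ∀ᶠ n in atTop, n ∈ Aᶜ → dist (f (H n)) (u n) < ε) ∧
      ∀ k, {n | H n = y k}.Infinite := by
  classical
  obtain ⟨ν, hν, hνd⟩ := extraction_forall_of_frequently
    (fun i : ℕ => hfreq i.unpair.1 (1 / ((i : ℝ) + 1)) (by positivity))
  choose s hs using hfs
  have hex : ∀ n, ∃ z : Y, (n ∈ A → z = B n) ∧ (∀ i, ν i = n → z = y i.unpair.1) ∧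
      (n ∉ A → n ∉ range ν → f z = u n) := by
    intro n
    by_cases hn : n ∈ A
    · refine ⟨B n, fun _ => rfl, ?_, fun h => absurd hn h⟩
      rintro i rfl
      exact absurd hn (hνd i).1
    · by_cases hr : n ∈ range ν
      · obtain ⟨i, rfl⟩ := hr
        refine ⟨y i.unpair.1, fun h => absurd h hn, ?_, fun _ h => absurd (mem_range_self i) h⟩
        intro j hj
        rw [hν.injective hj]
      · exact ⟨s (u n), fun h => absurd h hn, fun i hi => absurd ⟨i, hi⟩ hr, fun _ _ => hs _⟩
  choose H hHA hHν hHu using hex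
  refine ⟨H, hHA, ?_, ?_⟩
  · intro ε hε
    obtain ⟨m, hm⟩ := exists_nat_one_div_lt hε
    filter_upwards [eventually_ge_atTop (ν m)] with n hn hnA
    by_cases hr : n ∈ range ν
    · obtain ⟨i, rfl⟩ := hr
      have hmi : m ≤ i := hν.le_iff_le.1 hn
      rw [hHν _ i rfl, dist_comm]
      exact (hνd i).2.trans_le ((Nat.one_div_le_one_div hmi).trans hm.le)
    · rwa [hHu n hnA hr, dist_self]
  · intro k
    refine (infinite_range_of_injective (f := fun j => ν (Nat.pair k j)) ?_).mono ?_
    · intro i j hij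
      exact (Nat.pair_eq_pair.1 (hν.injective hij)).2
    · rintro _ ⟨j, rfl⟩
      simpa using hHν _ (Nat.pair k j) rfl

theorem stmt4 (K : Type*) [TopologicalSpace K] [CompactSpace K] [T2Space K] (hK : ZeroDim K)
    (η : K → ↥omegaStar) (hη : Topology.IsEmbedding η)
    (hcl : IsClosed (Set.range η)) (hnd : IsNowhereDense (Set.range η))
    (hP : IsPSet (Set.range η))
    (X Y : Type*)
    [TopologicalSpace X] [CompactSpace X] [TopologicalSpace.MetrizableSpace X] (hX : ZeroDim X)
    [TopologicalSpace Y] [CompactSpace Y] [TopologicalSpace.MetrizableSpace Y] (hY : ZeroDim Y)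
    (f : Y → X) (hf : Continuous f) (hfs : Surjective f)
    (b : K → Y) (hb : Continuous b)
    (g : ↥omegaStar → X) (hg : Continuous g) (hgs : Surjective g)
    (hcomm : g ∘ η = f ∘ b) :
    ∃ h : ↥omegaStar → Y, Continuous h ∧ Surjective h ∧ f ∘ h = g ∧ h ∘ η = b := by
  let := TopologicalSpace.metrizableSpaceMetric X
  let := TopologicalSpace.metrizableSpaceMetric Y
  obtain ⟨p₀⟩ : Nonempty ↥omegaStar :=
    let ⟨p, hp⟩ := nonempty_betaClosure_inter_omegaStar infinite_univ
    ⟨⟨p, hp.2⟩⟩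
  have : Nonempty X := ⟨g p₀⟩
  have : Nonempty Y := ⟨(hfs (g p₀)).choose⟩
  have hval : IsClosedEmbedding ((↑) : ↥omegaStar → StoneCech ℕ) :=
    isClosed_omegaStar.isClosedEmbedding_subtypeVal
  have hηc : IsClosedEmbedding η := ⟨hη, hcl⟩
  obtain ⟨G, hG, hGg⟩ := exists_continuous_extension_stoneCech hval hg
  obtain ⟨B, hB, hBb⟩ := exists_continuous_extension_stoneCech (hval.comp hηc) hb
  simp only [comp_apply] at hBb
  have hint : interior (range η) = ∅ := by
    rwa [IsNowhereDense, hcl.closure_eq] at hnd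
  let y := TopologicalSpace.denseSeq Y
  have hw : ∀ k, ∃ w : ↥omegaStar, w ∉ range η ∧ g w = f (y k) := by
    intro k
    obtain ⟨p, hp⟩ := hgs (f (y k))
    obtain ⟨w, hw, hwp⟩ := exists_notMem_fiber hG hint p
    exact ⟨w, hw, by rw [← hGg, hwp, hGg, hp]⟩
  choose w hwη hwy using hw
  let S : Set ↥omegaStar := {p | f (B p) = g p} ∩ ⋂ k, {w k}ᶜ
  have hSG : IsGδ S := by
    refine IsGδ.inter ?_ ?_
    · have hc : Continuous fun p : ↥omegaStar => (f (B p), g p) :=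
        (hf.comp (hB.comp continuous_subtype_val)).prodMk hg
      exact (isClosed_diagonal (X := X)).isGδ.preimage hc
    · exact IsGδ.iInter fun k => isOpen_compl_singleton.isGδ
  have hηS : range η ⊆ S := by
    rintro _ ⟨c, rfl⟩
    refine ⟨?_, mem_iInter.2 fun k hk => hwη k ⟨c, hk⟩⟩
    rw [mem_ofPred_eq, hBb]
    exact (congr_fun hcomm c).symm
  obtain ⟨O, hO, hOS⟩ := isOpen_induced_iff.1 (isOpen_interior (s := S))
  have hηO : range ((↑) ∘ η : K → StoneCech ℕ) ⊆ O := by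
    rintro _ ⟨c, rfl⟩
    have := hP.subset_interior_of_isGδ hSG hηS (mem_range_self c)
    rwa [← hOS] at this
  obtain ⟨A, hηA, hAO⟩ := exists_betaClosure_between (hval.comp hηc).isClosed_range hO hηO
  have hAS : ∀ p : ↥omegaStar, (p : StoneCech ℕ) ∈ betaClosure A → p ∈ S := by
    intro p hp
    have : p ∈ ((↑) ⁻¹' O : Set ↥omegaStar) := hAO hp
    rw [hOS] at this
    exact interior_subset this
  have hcover : ∀ p, p ∉ betaClosure A → p ∈ betaClosure Aᶜ := by
    intro p hp
    have : p ∈ betaClosure (A ∪ Aᶜ) := by simp [betaClosure_univ]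
    rw [betaClosure_union] at this
    exact this.resolve_left hp
  have hfreq : ∀ k, ∀ ε > 0,
      ∃ᶠ n in atTop, n ∈ Aᶜ ∧ dist (G (stoneCechUnit n)) (f (y k)) < ε := by
    intro k ε hε
    have hwA : (w k : StoneCech ℕ) ∉ betaClosure A := fun h =>
      mem_iInter.1 (hAS _ h).2 k rfl
    refine frequently_of_mem_betaClosure (w k).2 (hcover _ hwA)
      (O := {q | dist (G q) (f (y k)) < ε}) ?_
    refine (isOpen_lt (hG.dist continuous_const) continuous_const).mem_nhds ?_
    simpa [hGg, hwy] using hε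
  obtain ⟨H, hHA, hHd, hHy⟩ := exists_asymptotic_lift hfs (fun n => G (stoneCechUnit n))
    (fun n => B (stoneCechUnit n)) y A hfreq
  have hHc : Continuous H := continuous_of_discreteTopology
  have hh := continuous_stoneCechExtend hHc
  have hhB : EqOn (stoneCechExtend hHc) B (betaClosure A) :=
    eqOn_betaClosure hh hB fun n hn => by
      rw [stoneCechExtend_stoneCechUnit]
      exact hHA n hn
  have hcont : Continuous fun p : ↥omegaStar => stoneCechExtend hHc p :=
    hh.comp continuous_subtype_val
  refine ⟨fun p => stoneCechExtend hHc p, hcont, ?_, ?_, ?_⟩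
  · have : CompactSpace ↥omegaStar := isCompact_iff_compactSpace.1 isClosed_omegaStar.isCompact
    rw [← range_eq_univ, ← (isCompact_range hcont).isClosed.closure_eq]
    refine ((TopologicalSpace.denseRange_denseSeq Y).mono ?_).closure_eq
    rintro _ ⟨k, rfl⟩
    obtain ⟨q, hq, hq'⟩ := nonempty_betaClosure_inter_omegaStar (hHy k)
    refine ⟨⟨q, hq'⟩, eqOn_betaClosure hh continuous_const (fun n hn => ?_) hq⟩
    rw [stoneCechExtend_stoneCechUnit]
    exact hn
  · funext p
    by_cases hp : (p : StoneCech ℕ) ∈ betaClosure A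
    · simp only [comp_apply]
      rw [hhB hp]
      exact (hAS p hp).1
    · rw [← hGg]
      refine eq_of_tendsto_dist (hf.comp hh) hG (fun ε hε => ?_) p.2 (hcover _ hp)
      simpa [stoneCechExtend_stoneCechUnit] using hHd ε hε
  · funext c
    have hc : (η c : StoneCech ℕ) ∈ betaClosure A := hηA (mem_range_self c)
    simp only [comp_apply]
    rw [hhB hc, hBb]
end

section
/- Assume the Continuum Hypothesis. Then every compact Hausdorff 0-dimensional F-space of weight at most 𝔠 = 2^ℵ₀ can be embedded into ω* in such a way that its image is a nowhere dense closed P-set in ω*. -/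
open Set Function

universe u

/-- An Fσ subset of a topological space: a countable union of closed sets. -/
def IsFSigma {X : Type*} [TopologicalSpace X] (s : Set X) : Prop :=
  ∃ F : ℕ → Set X, (∀ n, IsClosed (F n)) ∧ s = ⋃ n, F n

/-- A space is an F-space if disjoint open Fσ-subsets have disjoint closures. -/
def FSpace (X : Type*) [TopologicalSpace X] : Prop :=
  ∀ U V : Set X, IsOpen U → IsOpen V → IsFSigma U → IsFSigma V → Disjoint U V →
    Disjoint (closure U) (closure V)

/-- The space `X` has weight (least cardinality of a base) at most `c`. -/
def WeightLE (X : Type u) [TopologicalSpace X] (c : Cardinal.{u}) : Prop :=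
  ∃ B : Set (Set X), TopologicalSpace.IsTopologicalBasis B ∧ Cardinal.mk B ≤ c

open Filter Topology in
/-- A sequence of sets `B n`, each of which is not covered modulo finite by finitely many of the
`C i`, can be split simultaneously by a single set that is almost disjoint from all the `C i`. -/
theorem exists_splitting_almost_disjoint (C B : ℕ → Set ℕ) :
    ∃ D : Set ℕ, (∀ i, (C i ∩ D).Finite) ∧
      ∀ n, (∀ m, (B n \ ⋃ i ≤ m, C i).Infinite) → (B n ∩ D).Infinite ∧ (B n \ D).Infinite := by
  by_cases hne : Nonempty {n // ∀ m, (B n \ ⋃ i ≤ m, C i).Infinite}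
  swap
  · refine ⟨∅, by simp, fun n hn => (hne ⟨n, hn⟩).elim⟩
  obtain ⟨s, hs⟩ := exists_surjective_nat {n // ∀ m, (B n \ ⋃ i ≤ m, C i).Infinite}
  obtain ⟨q, hq, hqB⟩ := extraction_forall_of_frequently
    (P := fun k j => j ∈ B (s (Nat.unpair (k / 2)).1) \ ⋃ i ≤ k, C i)
    (fun k => Nat.frequently_atTop_iff_infinite.2 ((s (Nat.unpair (k / 2)).1).2 k))
  refine ⟨range fun k => q (2 * k), fun i => ?_, fun n hn => ?_⟩
  · refine ((finite_lt_nat i).image q).subset ?_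
    rintro _ ⟨hx, k, rfl⟩
    refine ⟨2 * k, show 2 * k < i from not_le.1 fun hk => (hqB (2 * k)).2 ?_, rfl⟩
    exact mem_iUnion₂.2 ⟨i, hk, hx⟩
  · obtain ⟨a, ha⟩ := hs ⟨n, hn⟩
    have hmem : ∀ j e, e < 2 → q (2 * Nat.pair a j + e) ∈ B n := fun j e he => by
      have := (hqB (2 * Nat.pair a j + e)).1
      rwa [show (2 * Nat.pair a j + e) / 2 = Nat.pair a j by omega, Nat.unpair_pair, ha] at this
    have hinj : ∀ e, Injective fun j => q (2 * Nat.pair a j + e) := fun e j j' h => by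
      have h1 := hq.injective h
      have h2 : Nat.pair a j = Nat.pair a j' := by omega
      simpa using h2
    constructor
    · refine infinite_of_injective_forall_mem (hinj 0) fun j => ⟨hmem j 0 (by simp), ?_⟩
      exact ⟨Nat.pair a j, rfl⟩
    · refine infinite_of_injective_forall_mem (hinj 1) fun j => ⟨hmem j 1 (by simp), ?_⟩
      rintro ⟨k, hk⟩
      have := hq.injective hk
      omega

/-- In a compact 0-dimensional space, clopen sets separate a closed set from the complement of
an open neighborhood. -/
theorem exists_isClopen_between {X : Type*} [TopologicalSpace X] [CompactSpace X] (hX : ZeroDim X)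
    {C U : Set X} (hC : IsClosed C) (hU : IsOpen U) (hCU : C ⊆ U) :
    ∃ W, IsClopen W ∧ C ⊆ W ∧ W ⊆ U := by
  refine hC.isCompact.induction_on (p := fun C => ∃ W, IsClopen W ∧ C ⊆ W ∧ W ⊆ U)
    ⟨∅, isClopen_empty, subset_rfl, empty_subset _⟩ ?_ ?_ ?_
  · rintro s t hst ⟨W, hW, htW, hWU⟩
    exact ⟨W, hW, hst.trans htW, hWU⟩
  · rintro s t ⟨W, hW, hsW, hWU⟩ ⟨W', hW', htW', hWU'⟩
    exact ⟨W ∪ W', hW.union hW', union_subset_union hsW htW', union_subset hWU hWU'⟩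
  · intro x hx
    obtain ⟨W, hW, hxW, hWU⟩ := hX.exists_subset_of_mem_open (hCU hx) hU
    exact ⟨W, mem_nhdsWithin_of_mem_nhds (hW.isOpen.mem_nhds hxW), W, hW, subset_rfl, hWU⟩

theorem mk_clopens_le_continuum {X : Type u} [TopologicalSpace X] [CompactSpace X]
    (hw : WeightLE X Cardinal.continuum) :
    Cardinal.mk {a : Set X // IsClopen a} ≤ Cardinal.continuum := by
  obtain ⟨B, hB, hBc⟩ := hw
  have hfin : Cardinal.mk (Finset B) ≤ Cardinal.continuum := by
    cases finite_or_infinite B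
    · exact (Cardinal.mk_le_aleph0).trans Cardinal.aleph0_le_continuum
    · rwa [Cardinal.mk_finset_of_infinite]
  refine le_trans ?_ hfin
  have key : ∀ a : {a : Set X // IsClopen a}, ∃ s : Finset B, a.1 = ⋃ i ∈ s, i.1 := fun a => by
    obtain ⟨s, hs, h⟩ := eq_finite_iUnion_of_isTopologicalBasis_of_isCompact_open
      (Subtype.val : B → Set X) (by simpa using hB) a.1 a.2.isClosed.isCompact a.2.isOpen
    exact ⟨hs.toFinset, by simpa using h⟩
  choose f hf using key
  exact Cardinal.mk_le_of_injective (f := f) fun a b h => Subtype.ext (by rw [hf a, hf b, h])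

/-- A subalgebra of `𝒫(ℕ) × Clop(K)` that is the graph of a partial homomorphism
from `𝒫(ℕ)` modulo finite sets to `Clop(K)`. -/
structure IsPartialHom {K : Type*} [TopologicalSpace K] (G : Set (Set ℕ × Set K)) : Prop where
  isClopen : ∀ p ∈ G, IsClopen p.2
  top_mem : ⊤ ∈ G
  compl_mem : ∀ p ∈ G, pᶜ ∈ G
  inf_mem : ∀ p ∈ G, ∀ q ∈ G, p ⊓ q ∈ G
  eq_empty : ∀ p ∈ G, p.1.Finite → p.2 = ∅

namespace IsPartialHom

variable {K : Type u} [TopologicalSpace K] {G : Set (Set ℕ × Set K)}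

theorem bot_mem (hG : IsPartialHom G) : ⊥ ∈ G := by
  simpa using hG.compl_mem _ hG.top_mem

theorem sup_mem (hG : IsPartialHom G) {p q : Set ℕ × Set K} (hp : p ∈ G) (hq : q ∈ G) :
    p ⊔ q ∈ G := by
  simpa using hG.compl_mem _ (hG.inf_mem _ (hG.compl_mem _ hp) _ (hG.compl_mem _ hq))

theorem subset_of_diff_finite (hG : IsPartialHom G) {p q : Set ℕ × Set K} (hp : p ∈ G)
    (hq : q ∈ G) (h : (p.1 \ q.1).Finite) : p.2 ⊆ q.2 := by
  have := hG.eq_empty _ (hG.inf_mem _ hp _ (hG.compl_mem _ hq)) (by simpa [sdiff_eq] using h)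
  rw [← sdiff_eq_empty]
  simpa [sdiff_eq] using this

/-- The trivial partial homomorphism. -/
theorem pair_top_bot : IsPartialHom ({⊤, ⊥} : Set (Set ℕ × Set K)) where
  isClopen := by
    rintro p (rfl | rfl)
    exacts [isClopen_univ, isClopen_empty]
  top_mem := by simp
  compl_mem := by
    rintro p (rfl | rfl) <;> simp
  inf_mem := by
    rintro p (rfl | rfl) q (rfl | rfl) <;> simp
  eq_empty := by
    rintro p (rfl | rfl) h
    exacts [(infinite_univ h).elim, rfl]

/-- Adding a single compatible pair to a countable partial homomorphism. -/
theorem exists_insert (hG : IsPartialHom G) (hc : G.Countable) (t : Set ℕ × Set K)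
    (ht : IsClopen t.2) (h1 : ∀ p ∈ G, (p.1 ∩ t.1).Finite → p.2 ∩ t.2 = ∅)
    (h2 : ∀ p ∈ G, (p.1 \ t.1).Finite → p.2 ⊆ t.2) :
    ∃ G' : Set (Set ℕ × Set K), IsPartialHom G' ∧ G'.Countable ∧ G ⊆ G' ∧ t ∈ G' := by
  have hsplit : ∀ p : Set ℕ × Set K, p ⊓ t ⊔ p ⊓ tᶜ = p := fun p => by
    rw [← inf_sup_left, sup_compl_eq_top, inf_top_eq]
  refine ⟨image2 (fun p q => p ⊓ t ⊔ q ⊓ tᶜ) G G, ⟨?_, ?_, ?_, ?_, ?_⟩, hc.image2 hc _, ?_, ?_⟩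
  · rintro _ ⟨p, hp, q, hq, rfl⟩
    exact ((hG.isClopen p hp).inter ht).union ((hG.isClopen q hq).inter ht.compl)
  · exact ⟨⊤, hG.top_mem, ⊤, hG.top_mem, by simp⟩
  · rintro _ ⟨p, hp, q, hq, rfl⟩
    refine ⟨pᶜ, hG.compl_mem p hp, qᶜ, hG.compl_mem q hq, ?_⟩
    ext x <;> simp <;> tauto
  · rintro _ ⟨p, hp, q, hq, rfl⟩ _ ⟨p', hp', q', hq', rfl⟩
    refine ⟨p ⊓ p', hG.inf_mem p hp p' hp', q ⊓ q', hG.inf_mem q hq q' hq', ?_⟩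
    ext x <;> simp <;> tauto
  · rintro _ ⟨p, hp, q, hq, rfl⟩ hfin
    have e1 := h1 p hp (hfin.subset fun x hx => Or.inl hx)
    have e2 := h2 q hq (hfin.subset fun x hx => Or.inr hx)
    exact union_empty_iff.2 ⟨e1, sdiff_eq_empty.2 e2⟩
  · exact fun p hp => ⟨p, hp, p, hp, hsplit p⟩
  · exact ⟨⊤, hG.top_mem, ⊥, hG.bot_mem, by simp⟩

theorem exists_insert_left [CompactSpace K] (hK : ZeroDim K) (hF : FSpace K)
    (hG : IsPartialHom G) (hc : G.Countable) (x : Set ℕ) :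
    ∃ G' : Set (Set ℕ × Set K), IsPartialHom G' ∧ G'.Countable ∧ G ⊆ G' ∧ ∃ a, (x, a) ∈ G' := by
  have hFσ : ∀ S ⊆ G, IsOpen (⋃ p ∈ S, p.2) ∧ IsFSigma (⋃ p ∈ S, p.2) := by
    intro S hS
    refine ⟨isOpen_biUnion fun p hp => (hG.isClopen p (hS hp)).isOpen, ?_⟩
    rcases S.eq_empty_or_nonempty with rfl | hne
    · exact ⟨fun _ => ∅, fun _ => isClosed_empty, by simp⟩
    · obtain ⟨f, rfl⟩ := (hc.mono hS).exists_eq_range hne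
      exact ⟨fun n => (f n).2, fun n => (hG.isClopen _ (hS ⟨n, rfl⟩)).isClosed, by simp⟩
  obtain ⟨hU, hU'⟩ := hFσ {p ∈ G | (p.1 \ x).Finite} (sep_subset _ _)
  obtain ⟨hV, hV'⟩ := hFσ {p ∈ G | (p.1 ∩ x).Finite} (sep_subset _ _)
  have hdisj := hF _ _ hU hV hU' hV' <| by
    simp only [disjoint_iUnion_left, disjoint_iUnion_right]
    rintro p ⟨hp, hpx⟩ q ⟨hq, hqx⟩
    refine Disjoint.symm <| disjoint_iff_inter_eq_empty.2 (hG.eq_empty _ (hG.inf_mem p hp q hq) ?_)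
    exact (hpx.union hqx).subset (by intro n; simp; tauto)
  obtain ⟨a, ha, hUa, haV⟩ := exists_isClopen_between hK isClosed_closure
    isClosed_closure.isOpen_compl hdisj.subset_compl_right
  obtain ⟨G', h, h', hGG', hmem⟩ := hG.exists_insert hc (x, a) ha
    (fun p hp hpx => by
      rw [← disjoint_iff_inter_eq_empty, disjoint_comm, ← subset_compl_iff_disjoint_right]
      refine haV.trans (compl_subset_compl.2 (subset_closure.trans' ?_))
      exact subset_biUnion_of_mem (u := Prod.snd)
        (show p ∈ {p ∈ G | (p.1 ∩ x).Finite} from ⟨hp, hpx⟩))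
    (fun p hp hpx => hUa.trans' <| subset_closure.trans' <|
      subset_biUnion_of_mem (u := Prod.snd) (show p ∈ {p ∈ G | (p.1 \ x).Finite} from ⟨hp, hpx⟩))
  exact ⟨G', h, h', hGG', a, hmem⟩

theorem exists_insert_right (hG : IsPartialHom G) (hc : G.Countable) {a : Set K}
    (ha : IsClopen a) :
    ∃ G' : Set (Set ℕ × Set K), IsPartialHom G' ∧ G'.Countable ∧ G ⊆ G' ∧ ∃ x, (x, a) ∈ G' := by
  obtain ⟨f, rfl⟩ := hc.exists_eq_range ⟨⊤, hG.top_mem⟩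
  obtain ⟨x, -, hx⟩ := exists_splitting_almost_disjoint (fun _ => ∅) fun n => (f n).1
  simp only [iUnion_empty, sdiff_empty, forall_const] at hx
  obtain ⟨G', h, h', hGG', hmem⟩ := hG.exists_insert hc (x, a) ha
    (by
      rintro _ ⟨n, rfl⟩ hn
      rw [hG.eq_empty _ ⟨n, rfl⟩ (by_contra fun hinf => (hx n hinf).1 hn), empty_inter])
    (by
      rintro _ ⟨n, rfl⟩ hn
      rw [hG.eq_empty _ ⟨n, rfl⟩ (by_contra fun hinf => (hx n hinf).2 hn)]
      exact empty_subset _)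
  exact ⟨G', h, h', hGG', x, hmem⟩

theorem exists_insert_kernel (hG : IsPartialHom G) (hc : G.Countable) {z : Set ℕ}
    (h : ∀ p ∈ G, (p.1 \ z).Finite → p.2 = ∅) :
    ∃ G' : Set (Set ℕ × Set K), IsPartialHom G' ∧ G'.Countable ∧ G ⊆ G' ∧ (z, ∅) ∈ G' :=
  hG.exists_insert hc (z, ∅) isClopen_empty (fun p _ _ => inter_empty p.2)
    fun p hp hpz => (h p hp hpz).subset

theorem exists_infinite_subset_kernel (hG : IsPartialHom G) (hc : G.Countable) {x : Set ℕ}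
    (hx : x.Infinite) :
    ∃ G' : Set (Set ℕ × Set K), IsPartialHom G' ∧ G'.Countable ∧ G ⊆ G' ∧
      ∃ z ⊆ x, z.Infinite ∧ (z, ∅) ∈ G' := by
  obtain ⟨f, rfl⟩ := hc.exists_eq_range ⟨⊤, hG.top_mem⟩
  obtain ⟨y, -, hy⟩ := exists_splitting_almost_disjoint (fun _ => ∅) fun n => (f n).1 ∩ x
  simp only [iUnion_empty, sdiff_empty, forall_const] at hy
  obtain ⟨n, hn⟩ := hG.top_mem
  have hinf : (x ∩ y).Infinite := by
    have := (hy n (by simpa [hn] using hx)).1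
    simpa [hn] using this
  obtain ⟨G', h, h', hGG', hmem⟩ := hG.exists_insert_kernel hc (z := x ∩ y) (by
    rintro _ ⟨n, rfl⟩ hn
    refine hG.eq_empty _ ⟨n, rfl⟩ ?_
    have h1 : ((f n).1 ∩ x).Finite := by_contra fun hinf =>
      (hy n hinf).2 (hn.subset (by intro m; simp; tauto))
    exact (h1.union hn).subset (by intro m; simp; tauto))
  exact ⟨G', h, h', hGG', _, inter_subset_left, hinf, hmem⟩

theorem exists_kernel_bound (hG : IsPartialHom G) (hc : G.Countable) :
    ∃ G' : Set (Set ℕ × Set K), IsPartialHom G' ∧ G'.Countable ∧ G ⊆ G' ∧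
      ∃ w, (w, ∅) ∈ G' ∧ ∀ z, (z, ∅) ∈ G → (z \ w).Finite := by
  classical
  obtain ⟨f, hf⟩ := hc.exists_eq_range ⟨⊤, hG.top_mem⟩
  have hfG : ∀ n, f n ∈ G := fun n => hf ▸ mem_range_self n
  let C : ℕ → Set ℕ := fun n => if (f n).2 = ∅ then (f n).1 else ∅
  have hC : ∀ n, (C n, ∅) ∈ G := fun n => by
    by_cases hn : (f n).2 = ∅
    · have : (C n, (∅ : Set K)) = f n := Prod.ext (by simp [C, hn]) hn.symm
      exact this ▸ hfG n
    · have : C n = ∅ := by simp [C, hn]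
      exact this ▸ hG.bot_mem
  have hCU : ∀ m, (⋃ i ≤ m, C i, (∅ : Set K)) ∈ G := fun m => by
    induction m with
    | zero => simpa using hC 0
    | succ m ih =>
      have := hG.sup_mem ih (hC (m + 1))
      simpa [Nat.le_succ_iff, iUnion_or, iUnion_union_distrib] using this
  obtain ⟨D, hD, hD'⟩ := exists_splitting_almost_disjoint C fun n => (f n).1
  obtain ⟨G', h, h', hGG', hmem⟩ := hG.exists_insert_kernel hc (z := Dᶜ) (by
    intro p hp hfin
    obtain ⟨n, rfl⟩ : p ∈ range f := hf ▸ hp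
    by_contra hne
    refine (hD' n fun m hm => hne ?_).1 (by simpa [Set.sdiff_eq] using hfin)
    exact subset_empty_iff.1 (hG.subset_of_diff_finite hp (hCU m) hm))
  refine ⟨G', h, h', hGG', _, hmem, fun z hz => ?_⟩
  obtain ⟨n, hn⟩ : (z, ∅) ∈ range f := hf ▸ hz
  simpa [C, hn, Set.sdiff_eq] using hD n

theorem exists_extension [CompactSpace K] (hK : ZeroDim K) (hF : FSpace K)
    (hG : IsPartialHom G) (hc : G.Countable) (x : Set ℕ) {a : Set K} (ha : IsClopen a) :
    ∃ G' : Set (Set ℕ × Set K), IsPartialHom G' ∧ G'.Countable ∧ G ⊆ G' ∧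
      (∃ a, (x, a) ∈ G') ∧ (∃ x, (x, a) ∈ G') ∧
      (x.Infinite → ∃ z ⊆ x, z.Infinite ∧ (z, ∅) ∈ G') ∧
      ∃ w, (w, ∅) ∈ G' ∧ ∀ z, (z, ∅) ∈ G → (z \ w).Finite := by
  obtain ⟨G₁, h₁, c₁, s₁, w, hw, hw'⟩ := hG.exists_kernel_bound hc
  obtain ⟨G₂, h₂, c₂, s₂, b, hb⟩ := h₁.exists_insert_left hK hF c₁ x
  obtain ⟨G₃, h₃, c₃, s₃, y, hy⟩ := h₂.exists_insert_right c₂ ha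
  have tail : ∀ G' : Set (Set ℕ × Set K), G₃ ⊆ G' →
      G ⊆ G' ∧ (x, b) ∈ G' ∧ (y, a) ∈ G' ∧ (w, ∅) ∈ G' := fun G' s =>
    ⟨s₁.trans (s₂.trans (s₃.trans s)), s (s₃ hb), s hy, s (s₃ (s₂ hw))⟩
  by_cases hx : x.Infinite
  · obtain ⟨G₄, h₄, c₄, s₄, hz⟩ := h₃.exists_infinite_subset_kernel c₃ hx
    obtain ⟨t₁, t₂, t₃, t₄⟩ := tail G₄ s₄
    exact ⟨G₄, h₄, c₄, t₁, ⟨b, t₂⟩, ⟨y, t₃⟩, fun _ => hz, w, t₄, hw'⟩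
  · obtain ⟨t₁, t₂, t₃, t₄⟩ := tail G₃ subset_rfl
    exact ⟨G₃, h₃, c₃, t₁, ⟨b, t₂⟩, ⟨y, t₃⟩, fun h => (hx h).elim, w, t₄, hw'⟩

end IsPartialHom

namespace IsPartialHom

variable {K : Type u} [TopologicalSpace K] {G : Set (Set ℕ × Set K)}

theorem sUnion {S : Set (Set (Set ℕ × Set K))} (hS : IsChain (· ⊆ ·) S) (hne : S.Nonempty)
    (h : ∀ G ∈ S, IsPartialHom G) : IsPartialHom (⋃₀ S) where
  isClopen := by
    rintro p ⟨G, hG, hp⟩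
    exact (h G hG).isClopen p hp
  top_mem := hne.elim fun G hG => ⟨G, hG, (h G hG).top_mem⟩
  compl_mem := by
    rintro p ⟨G, hG, hp⟩
    exact ⟨G, hG, (h G hG).compl_mem p hp⟩
  inf_mem := by
    rintro p ⟨G, hG, hp⟩ q ⟨G', hG', hq⟩
    obtain ⟨G'', hG'', s, s'⟩ := hS.directedOn G hG G' hG'
    exact ⟨G'', hG'', (h G'' hG'').inf_mem p (s hp) q (s' hq)⟩
  eq_empty := by
    rintro p ⟨G, hG, hp⟩
    exact (h G hG).eq_empty p hp

/-- Under the Continuum Hypothesis, if `K` is a compact 0-dimensional F-space of weight at most `𝔠`,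
there is a homomorphism from `𝒫(ℕ)` modulo finite sets onto `Clop(K)` whose kernel is
dense and countably directed. -/
theorem exists_surjective (ch : Cardinal.continuum.{0} = Cardinal.aleph 1)
    [CompactSpace K] (hK : ZeroDim K) (hF : FSpace K) (hw : WeightLE K Cardinal.continuum) :
    ∃ G : Set (Set ℕ × Set K), IsPartialHom G ∧ (∀ x, ∃ a, (x, a) ∈ G) ∧
      (∀ a, IsClopen a → ∃ x, (x, a) ∈ G) ∧
      (∀ x : Set ℕ, x.Infinite → ∃ z ⊆ x, z.Infinite ∧ (z, ∅) ∈ G) ∧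
      ∀ z : ℕ → Set ℕ, (∀ n, (z n, ∅) ∈ G) → ∃ w, (w, ∅) ∈ G ∧ ∀ n, (z n \ w).Finite := by
  let ι : Type := (Cardinal.aleph 1).ord.ToType
  have hι : Cardinal.mk ι = Cardinal.aleph 1 := Cardinal.mk_ord_toType _
  have hIio : ∀ i : ι, (Iio i).Countable := fun i => by
    rw [← Cardinal.le_aleph0_iff_set_countable, ← Cardinal.lt_aleph_one_iff]
    exact (Cardinal.mk_Iio_lt i (by simp [ι])).trans_eq hι
  have hunc : Uncountable ι := by
    rw [← Cardinal.aleph0_lt_mk_iff, hι]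
    exact Cardinal.aleph0_lt_aleph_one
  obtain ⟨e, he⟩ : ∃ e : ι → Set ℕ × {a : Set K // IsClopen a}, Surjective e := by
    have : Nonempty {a : Set K // IsClopen a} := ⟨⟨∅, isClopen_empty⟩⟩
    have hle : Cardinal.lift.{0} (Cardinal.mk (Set ℕ × {a : Set K // IsClopen a})) ≤
        Cardinal.lift.{u} (Cardinal.mk ι) := by
      rw [hι, ← ch, Cardinal.lift_continuum, Cardinal.lift_uzero, Cardinal.mk_prod,
        Cardinal.mk_set_nat, Cardinal.lift_continuum, Cardinal.lift_uzero]
      exact (mul_le_mul_right (mk_clopens_le_continuum hw) _).trans_eq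
        Cardinal.continuum_mul_self
    obtain ⟨f⟩ := Cardinal.lift_mk_le'.1 hle
    exact ⟨invFun f, invFun_surjective f.injective⟩
  have hstep : ∀ (G : Set (Set ℕ × Set K)) (i : ι), ∃ G' : Set (Set ℕ × Set K),
      IsPartialHom G → G.Countable → IsPartialHom G' ∧ G'.Countable ∧ G ⊆ G' ∧
      (∃ a, ((e i).1, a) ∈ G') ∧ (∃ x, (x, (e i).2.1) ∈ G') ∧
      ((e i).1.Infinite → ∃ z ⊆ (e i).1, z.Infinite ∧ (z, ∅) ∈ G') ∧
      ∃ w, (w, ∅) ∈ G' ∧ ∀ z, (z, ∅) ∈ G → (z \ w).Finite := fun G i => by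
    by_cases h : IsPartialHom G ∧ G.Countable
    · obtain ⟨G', h'⟩ := h.1.exists_extension hK hF h.2 (e i).1 (e i).2.2
      exact ⟨G', fun _ _ => h'⟩
    · exact ⟨∅, fun h1 h2 => (h ⟨h1, h2⟩).elim⟩
  choose F hFstep using hstep
  let g : ι → Set (Set ℕ × Set K) := WellFoundedLT.fix fun i ih =>
    F (⋃₀ insert {⊤, ⊥} {s | ∃ j, ∃ h : j < i, ih j h = s}) i
  let H : ι → Set (Set ℕ × Set K) := fun i => ⋃₀ insert {⊤, ⊥} (g '' Iio i)
  have hg : ∀ i, g i = F (H i) i := fun i => by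
    simp only [g, H]
    rw [WellFoundedLT.fix_eq]
    congr 3
    ext s
    simp
  have hgH : ∀ {i j}, j < i → g j ⊆ H i := fun {i j} hji =>
    subset_sUnion_of_mem (mem_insert_of_mem _ ⟨j, hji, rfl⟩)
  have hchain : ∀ s : Set ι, (∀ i ∈ s, H i ⊆ g i) →
      IsChain (· ⊆ ·) (insert {⊤, ⊥} (g '' s)) := fun s hs => by
    refine IsChain.insert ?_ ?_
    · rintro _ ⟨i, hi, rfl⟩ _ ⟨j, hj, rfl⟩ hne
      rcases lt_trichotomy i j with h | h | h
      · exact Or.inl ((hgH h).trans (hs j hj))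
      · exact (hne (by rw [h])).elim
      · exact Or.inr ((hgH h).trans (hs i hi))
    · rintro _ ⟨i, hi, rfl⟩ -
      exact Or.inl ((subset_sUnion_of_mem (mem_insert _ _)).trans (hs i hi))
  have hH : ∀ i, IsPartialHom (H i) ∧ (H i).Countable := fun i => by
    induction i using WellFoundedLT.induction with
    | ind i ih =>
      have hstep : ∀ j < i, IsPartialHom (g j) ∧ (g j).Countable ∧ H j ⊆ g j := fun j hj => by
        obtain ⟨h1, h2, h3, -⟩ := hFstep (H j) j (ih j hj).1 (ih j hj).2
        rw [hg]
        exact ⟨h1, h2, h3⟩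
      refine ⟨sUnion (hchain _ fun j hj => (hstep j hj).2.2) ⟨_, mem_insert _ _⟩ ?_, ?_⟩
      · rintro _ (rfl | ⟨j, hj, rfl⟩)
        exacts [pair_top_bot, (hstep j hj).1]
      · refine (((hIio i).image g).insert _).sUnion ?_
        rintro _ (rfl | ⟨j, hj, rfl⟩)
        exacts [by simp, (hstep j hj).2.1]
  have hgs := fun i => hg i ▸ hFstep (H i) i (hH i).1 (hH i).2
  have hsub : ∀ i, g i ⊆ ⋃₀ insert {⊤, ⊥} (g '' univ) := fun i =>
    subset_sUnion_of_mem (mem_insert_of_mem _ ⟨i, mem_univ i, rfl⟩)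
  refine ⟨⋃₀ insert {⊤, ⊥} (g '' univ),
    sUnion (hchain _ fun i _ => (hgs i).2.2.1) ⟨_, mem_insert _ _⟩ ?_, ?_, ?_, ?_, ?_⟩
  · rintro _ (rfl | ⟨i, -, rfl⟩)
    exacts [pair_top_bot, (hgs i).1]
  · intro x
    obtain ⟨i, hi⟩ := he (x, ⟨∅, isClopen_empty⟩)
    obtain ⟨a, ha⟩ := (hgs i).2.2.2.1
    exact ⟨a, hsub i (by simpa [hi] using ha)⟩
  · intro a ha
    obtain ⟨i, hi⟩ := he (∅, ⟨a, ha⟩)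
    obtain ⟨x, hx⟩ := (hgs i).2.2.2.2.1
    exact ⟨x, hsub i (by simpa [hi] using hx)⟩
  · intro x hx
    obtain ⟨i, hi⟩ := he (x, ⟨∅, isClopen_empty⟩)
    obtain ⟨z, hzx, hz, hmem⟩ := (hgs i).2.2.2.2.2.1 (by rwa [hi])
    exact ⟨z, by rwa [hi] at hzx, hz, hsub i hmem⟩
  · intro z hz
    have hz' : ∀ n, ∃ i, (z n, (∅ : Set K)) ∈ g i := fun n => by
      obtain ⟨_, rfl | ⟨i, -, rfl⟩, hi⟩ := hz n
      · obtain ⟨i⟩ : Nonempty ι := inferInstance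
        exact ⟨i, (hgs i).2.2.1 ⟨_, mem_insert _ _, hi⟩⟩
      · exact ⟨i, hi⟩
    choose i hi using hz'
    obtain ⟨k, hk⟩ : (⋃ n, Iic (i n))ᶜ.Nonempty := by
      by_contra hne
      rw [not_nonempty_iff_eq_empty, compl_empty_iff] at hne
      refine not_countable_univ (α := ι) (hne ▸ countable_iUnion fun n => ?_)
      rw [← Iio_insert]
      exact (hIio _).insert _
    simp only [mem_compl_iff, mem_iUnion, mem_Iic, not_exists, not_le] at hk
    obtain ⟨w, hw, hw'⟩ := (hgs k).2.2.2.2.2.2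
    exact ⟨w, hsub k hw, fun n => hw' _ (hgH (hk n) (hi n))⟩

end IsPartialHom

/-- The Čech–Stone compactification of `ℕ` as the space of ultrafilters. -/
noncomputable def stoneCechHomeomorphUltrafilter : StoneCech ℕ ≃ₜ Ultrafilter ℕ where
  toFun := stoneCechExtend (continuous_of_discreteTopology (f := (pure : ℕ → Ultrafilter ℕ)))
  invFun := Ultrafilter.extend stoneCechUnit
  left_inv := congr_fun <| stoneCech_hom_ext
    ((continuous_ultrafilter_extend _).comp (continuous_stoneCechExtend _)) continuous_id
    (by ext n; simp)
  right_inv := congr_fun <| denseRange_pure.equalizer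
    ((continuous_stoneCechExtend _).comp (continuous_ultrafilter_extend _)) continuous_id
    (by ext n; simp)
  continuous_toFun := continuous_stoneCechExtend _
  continuous_invFun := continuous_ultrafilter_extend _

theorem stoneCechHomeomorphUltrafilter_unit (n : ℕ) :
    stoneCechHomeomorphUltrafilter (stoneCechUnit n) = pure n :=
  stoneCechExtend_stoneCechUnit continuous_of_discreteTopology n

theorem mem_omegaStar_iff {p : StoneCech ℕ} :
    p ∈ omegaStar ↔ ∀ s ∈ stoneCechHomeomorphUltrafilter p, s.Infinite := by
  refine ⟨fun hp s hs hfin => hp ?_, ?_⟩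
  · obtain ⟨n, -, hn⟩ := Ultrafilter.eq_pure_of_finite_mem hfin hs
    refine ⟨n, stoneCechHomeomorphUltrafilter.injective ?_⟩
    rw [hn, stoneCechHomeomorphUltrafilter_unit]
  · rintro h ⟨n, rfl⟩
    refine h {n} ?_ (finite_singleton n)
    rw [stoneCechHomeomorphUltrafilter_unit]
    exact Ultrafilter.mem_pure.2 rfl

/-- The clopen subset of `ω*` determined by a set of natural numbers. -/
def omegaStarBasic (s : Set ℕ) : Set omegaStar :=
  {p | s ∈ stoneCechHomeomorphUltrafilter p.1}

theorem isTopologicalBasis_omegaStarBasic :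
    TopologicalSpace.IsTopologicalBasis (range omegaStarBasic) := by
  have h := (ultrafilterBasis_is_basis (α := ℕ)).isInducing
    (stoneCechHomeomorphUltrafilter.isInducing.comp
      (Topology.IsInducing.subtypeVal (t := omegaStar)))
  convert h using 1
  simp only [ultrafilterBasis, ← range_comp]
  rfl

theorem omegaStarBasic_subset {s t : Set ℕ} (h : (s \ t).Finite) :
    omegaStarBasic s ⊆ omegaStarBasic t := by
  intro p hp
  by_contra ht
  refine mem_omegaStar_iff.1 p.2 _ ?_ h
  exact Filter.inter_mem hp (Ultrafilter.compl_mem_iff_notMem.2 ht)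

theorem omegaStarBasic_nonempty {s : Set ℕ} (h : s.Infinite) : (omegaStarBasic s).Nonempty := by
  have : (Filter.cofinite ⊓ Filter.principal s).NeBot := h.cofinite_inf_principal_neBot
  let v := Ultrafilter.of (Filter.cofinite ⊓ Filter.principal s)
  have hv : (v : Filter ℕ) ≤ Filter.cofinite ⊓ Filter.principal s := Ultrafilter.of_le _
  refine ⟨⟨stoneCechHomeomorphUltrafilter.symm v, mem_omegaStar_iff.2 fun t ht hfin => ?_⟩, ?_⟩
  · rw [Homeomorph.apply_symm_apply] at ht
    exact Ultrafilter.compl_mem_iff_notMem.1 (hv.trans inf_le_left hfin.compl_mem_cofinite) ht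
  · simpa [omegaStarBasic] using hv.trans inf_le_right (Filter.mem_principal_self s)

theorem stmt5 (ch : Cardinal.continuum.{0} = Cardinal.aleph 1)
    (K : Type u) [TopologicalSpace K] [CompactSpace K] [T2Space K] (hK : ZeroDim K)
    (hF : FSpace K) (hw : WeightLE K Cardinal.continuum) :
    ∃ η : K → ↥omegaStar, Topology.IsEmbedding η ∧ IsClosed (Set.range η) ∧
      IsNowhereDense (Set.range η) ∧ IsPSet (Set.range η) := by
  obtain ⟨G, hG, htotal, hsurj, hdense, hdir⟩ := IsPartialHom.exists_surjective ch hK hF hw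
  have hmono : ∀ {x y a b}, (x, a) ∈ G → (y, b) ∈ G → x ⊆ y → a ⊆ b := fun hx hy hxy =>
    hG.subset_of_diff_finite hx hy (by simp [sdiff_eq_empty.2 hxy])
  choose h hh using htotal
  have hh_eq : ∀ {x a}, (x, a) ∈ G → h x = a := fun {x a} hx =>
    (hmono (hh x) hx subset_rfl).antisymm (hmono hx (hh x) subset_rfl)
  have hcompl : ∀ x, h xᶜ = (h x)ᶜ := fun x => hh_eq (hG.compl_mem _ (hh x))
  have hinter : ∀ x y, h (x ∩ y) = h x ∩ h y := fun x y =>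
    hh_eq (hG.inf_mem _ (hh x) _ (hh y))
  have hfinite : ∀ {x : Set ℕ}, x.Finite → h x = ∅ := fun {x} hx => hG.eq_empty _ (hh x) hx
  let F : K → Filter ℕ := fun k =>
    { sets := {x | k ∈ h x}
      univ_sets := by
        exact (hh_eq hG.top_mem).superset (mem_univ k)
      sets_of_superset := fun {x y} hx hxy => hmono (hh x) (hh y) hxy hx
      inter_sets := fun {x y} hx hy => by
        rw [mem_ofPred_eq, hinter]
        exact ⟨hx, hy⟩ }
  have hFmem : ∀ {k x}, x ∈ F k ↔ k ∈ h x := Iff.rfl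
  let u : K → Ultrafilter ℕ := fun k => Ultrafilter.ofComplNotMemIff (F k) fun x => by
    simp [hFmem, hcompl]
  have hu : ∀ {k x}, x ∈ u k ↔ k ∈ h x := Iff.rfl
  let η : K → omegaStar := fun k => ⟨stoneCechHomeomorphUltrafilter.symm (u k),
    mem_omegaStar_iff.2 fun s hs hfin => by
      simp [hu, hfinite hfin] at hs⟩
  have hη : ∀ {s k}, η k ∈ omegaStarBasic s ↔ k ∈ h s := fun {s k} => by
    simp [omegaStarBasic, η, hu]
  have hcont : Continuous η := by
    rw [isTopologicalBasis_omegaStarBasic.continuous_iff]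
    rintro _ ⟨s, rfl⟩
    rw [show η ⁻¹' omegaStarBasic s = h s from ext fun k => hη]
    exact (hG.isClopen _ (hh s)).isOpen
  have hinj : Injective η := fun k k' hkk' => by
    by_contra hne
    obtain ⟨a, ha, hka, hak'⟩ := hK.exists_subset_of_mem_open (show k ∈ ({k'} : Set K)ᶜ from hne)
      isOpen_compl_singleton
    obtain ⟨x, hx⟩ := hsurj a ha
    refine hak' (show k' ∈ a from ?_) rfl
    rw [← hh_eq hx, ← hη, ← hkk', hη, hh_eq hx]
    exact hka
  have hemb := hcont.isClosedEmbedding hinj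
  refine ⟨η, hemb.isEmbedding, hemb.isClosed_range, ?_, fun V hV => ?_⟩
  · rw [IsNowhereDense, hemb.isClosed_range.closure_eq, ← not_nonempty_iff_eq_empty]
    rintro ⟨p, hp⟩
    obtain ⟨_, ⟨s, rfl⟩, hps, hs⟩ :=
      isTopologicalBasis_omegaStarBasic.exists_subset_of_mem_open hp isOpen_interior
    obtain ⟨z, hzs, hz, hzG⟩ := hdense s (mem_omegaStar_iff.1 p.2 s hps)
    obtain ⟨q, hq⟩ := omegaStarBasic_nonempty hz
    obtain ⟨k, rfl⟩ := interior_subset (hs (omegaStarBasic_subset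
      (by simp [sdiff_eq_empty.2 hzs]) hq))
    rw [hη, hh_eq hzG] at hq
    exact hq
  · have key : ∀ n, ∃ s, h s = univ ∧ omegaStarBasic s ⊆ V n := fun n => by
      suffices ∃ s, univ ⊆ h s ∧ omegaStarBasic s ⊆ V n by simpa only [univ_subset_iff] using this
      refine isCompact_univ.induction_on (p := fun C => ∃ s, C ⊆ h s ∧ omegaStarBasic s ⊆ V n)
        ?_ ?_ ?_ ?_
      · refine ⟨∅, empty_subset _, fun p hp => ?_⟩
        exact (mem_omegaStar_iff.1 p.2 _ hp finite_empty).elim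
      · rintro C D hCD ⟨s, hs, hsV⟩
        exact ⟨s, hCD.trans hs, hsV⟩
      · rintro C D ⟨s, hs, hsV⟩ ⟨t, ht, htV⟩
        refine ⟨s ∪ t, union_subset (hs.trans ?_) (ht.trans ?_), fun p hp => ?_⟩
        · exact hmono (hh s) (hh _) subset_union_left
        · exact hmono (hh t) (hh _) subset_union_right
        · exact (Ultrafilter.union_mem_iff.1 hp).elim (fun h => hsV h) fun h => htV h
      · intro k _
        obtain ⟨_, ⟨s, rfl⟩, hks, hs⟩ := isTopologicalBasis_omegaStarBasic.exists_subset_of_mem_open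
          (hV n ⟨k, rfl⟩) isOpen_interior
        refine ⟨h s, mem_nhdsWithin_of_mem_nhds ?_, s, subset_rfl, hs.trans interior_subset⟩
        exact (hG.isClopen _ (hh s)).isOpen.mem_nhds (hη.1 hks)
    choose s hs hsV using key
    obtain ⟨w, hwG, hw'⟩ := hdir (fun n => (s n)ᶜ) fun n => by
      have := hh (s n)ᶜ
      rwa [hcompl, hs, compl_univ] at this
    have hsub : omegaStarBasic wᶜ ⊆ ⋂ n, V n := subset_iInter fun n =>
      (omegaStarBasic_subset ((hw' n).subset (by intro m; simp; tauto))).trans (hsV n)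
    refine Subset.trans ?_ (interior_maximal hsub
      (isTopologicalBasis_omegaStarBasic.isOpen ⟨_, rfl⟩))
    rintro _ ⟨k, rfl⟩
    rw [hη, hcompl, hh_eq hwG, compl_empty]
    trivial
end
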